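/- For every n ∈ ℕ with n ≥ 1, every integer s with 1 ≤ s ≤ m_n − 1, and every x ∈ I_{n+1}(e_{n−1} + e_n), one has |K_{s M_n}(x)| ≥ M_n / (2π s). -/

import Mathlib

open MeasureTheory Finset

noncomputable section

namespace Vilenkin

instance (n : ℕ) : MeasurableSpace (ZMod n) := ⊤

abbrev G (m : ℕ → ℕ) : Type := ∀ k, ZMod (m k)

def M (m : ℕ → ℕ) : ℕ → ℕ
  | 0 => 1
  | k + 1 => m k * M m k

def digit (m : ℕ → ℕ) (n k : ℕ) : ℕ := (n / M m k) % m k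

def rad (m : ℕ → ℕ) (k : ℕ) (x : G m) : ℂ :=
  Complex.exp (2 * (Real.pi : ℂ) * Complex.I * ((x k).val : ℂ) / (m k : ℂ))

def psi (m : ℕ → ℕ) (n : ℕ) (x : G m) : ℂ :=
  ∏ k ∈ Finset.range (n + 1), rad m k x ^ digit m n k

def D (m : ℕ → ℕ) (n : ℕ) (x : G m) : ℂ := ∑ k ∈ Finset.range n, psi m k x

def K (m : ℕ → ℕ) (n : ℕ) (x : G m) : ℂ := (n : ℂ)⁻¹ * ∑ k ∈ Finset.range n, D m k x

def cyl (m : ℕ → ℕ) (n : ℕ) (x : G m) : Set (G m) := {y | ∀ j < n, y j = x j}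

def e (m : ℕ → ℕ) (k : ℕ) : G m := fun j => if j = k then 1 else 0

def lo (m : ℕ → ℕ) (n : ℕ) : ℕ := sInf {j | digit m n j ≠ 0}

def hi (m : ℕ → ℕ) (n : ℕ) : ℕ := sSup {j | digit m n j ≠ 0}

def Iij (m : ℕ → ℕ) (N i j : ℕ) : Set (G m) :=
  if j = N then {x | x i ≠ 0 ∧ ∀ t < N, t ≠ i → x t = 0}
  else {x | (∀ t < i, x t = 0) ∧ x i ≠ 0 ∧ (∀ t, i < t → t < j → x t = 0) ∧ x j ≠ 0}

def IsVilenkinMeasure (m : ℕ → ℕ) (μ : Measure (G m)) : Prop :=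
  IsProbabilityMeasure μ ∧ ∀ (n : ℕ) (x : G m), μ (cyl m n x) = (M m n : ENNReal)⁻¹

def fhat (m : ℕ → ℕ) (μ : Measure (G m)) (f : G m → ℂ) (k : ℕ) : ℂ :=
  ∫ x, f x * (starRingEnd ℂ) (psi m k x) ∂μ

def S (m : ℕ → ℕ) (μ : Measure (G m)) (f : G m → ℂ) (n : ℕ) (x : G m) : ℂ :=
  ∑ k ∈ Finset.range n, fhat m μ f k * psi m k x

def sigma (m : ℕ → ℕ) (μ : Measure (G m)) (f : G m → ℂ) (n : ℕ) (x : G m) : ℂ :=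
  (n : ℂ)⁻¹ * ∑ k ∈ Finset.range n, S m μ f k x

end Vilenkin

open Vilenkin

namespace Vilenkin

theorem rad_eq_one {m : ℕ → ℕ} {k : ℕ} {x : G m} (h : x k = 0) : rad m k x = 1 := by
  simp [rad, h]

theorem rad_eq_exp {m : ℕ → ℕ} {k : ℕ} {x : G m} (hm : 2 ≤ m k) (h : x k = 1) :
    rad m k x = Complex.exp (Complex.I * ((2 * Real.pi / m k : ℝ) : ℂ)) := by
  have : Fact (1 < m k) := ⟨hm⟩
  rw [rad, h, ZMod.val_one]
  push_cast
  ring_nf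

theorem M_pos {m : ℕ → ℕ} (hm : ∀ k, 2 ≤ m k) (k : ℕ) : 0 < M m k := by
  induction k with
  | zero => simp [M]
  | succ k ih => exact Nat.mul_pos (by linarith [hm k]) ih

theorem lt_M {m : ℕ → ℕ} (hm : ∀ k, 2 ≤ m k) (k : ℕ) : k < M m k := by
  induction k with
  | zero => simp [M]
  | succ k ih =>
    have := Nat.mul_le_mul_right (M m k) (hm k)
    simp only [M]
    omega

theorem M_mono {m : ℕ → ℕ} (hm : ∀ k, 2 ≤ m k) : Monotone (M m) :=
  monotone_nat_of_le_succ fun k => Nat.le_mul_of_pos_left _ (by linarith [hm k])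

theorem digit_eq_zero_of_lt {m : ℕ → ℕ} {k j : ℕ} (h : k < M m j) : digit m k j = 0 := by
  simp [digit, Nat.div_eq_of_lt h]

/-- If `x` vanishes below `p`, only the digits at `p` and `p + 1` of an index below `M (p + 2)`
contribute to the value of the corresponding Vilenkin function at `x`. -/
theorem psi_eq_mul {m : ℕ → ℕ} (hm : ∀ k, 2 ≤ m k) {p k : ℕ} {x : G m}
    (hx : ∀ j < p, x j = 0) (hk : k < M m (p + 2)) :
    psi m k x = rad m (p + 1) x ^ digit m k (p + 1) * rad m p x ^ digit m k p := by
  have h₁ : psi m k x = ∏ j ∈ range (k + p + 2), rad m j x ^ digit m k j := by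
    refine prod_subset (by intro j; simp only [mem_range]; omega) fun j _ hj => ?_
    have hkj : k < j := by simpa using hj
    rw [digit_eq_zero_of_lt (hkj.trans (lt_M hm j)), pow_zero]
  have h₂ : ∏ j ∈ {p + 1, p}, rad m j x ^ digit m k j
      = ∏ j ∈ range (k + p + 2), rad m j x ^ digit m k j := by
    refine prod_subset (by intro j; simp only [mem_range, mem_insert, mem_singleton]; omega)
      fun j _ hj => ?_
    simp only [mem_insert, mem_singleton, not_or] at hj
    rcases lt_or_ge j p with h | h
    · rw [rad_eq_one (hx j h), one_pow]
    · rw [digit_eq_zero_of_lt (hk.trans_le (M_mono hm (by omega))), pow_zero]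
  rw [h₁, ← h₂, prod_pair (by omega)]

theorem sum_range_mul_eq {E : Type*} [AddCommMonoid E] (g : ℕ → E) (a b : ℕ) :
    ∑ k ∈ range (a * b), g k = ∑ i ∈ range a, ∑ j ∈ range b, g (i * b + j) := by
  induction a with
  | zero => simp
  | succ a ih => rw [Nat.succ_mul, sum_range_add, ih, sum_range_succ]

/-- Iterated partial sums of a sequence that is `r`-quasi-periodic with period `T` and
whose sum over one period vanishes. -/
theorem sum_sum_range_quasiperiodic {R : Type*} [CommRing R] {f : ℕ → R} {r : R} {s T : ℕ}
    (hf : ∀ a < s, ∀ b < T, f (a * T + b) = r ^ a * f b) (h₀ : ∑ j ∈ range T, f j = 0) :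
    ∑ k ∈ range (s * T), ∑ j ∈ range k, f j
      = (∑ a ∈ range s, r ^ a) * ∑ k ∈ range T, ∑ j ∈ range k, f j := by
  rw [sum_range_mul_eq, sum_mul]
  refine sum_congr rfl fun a ha => ?_
  rw [mem_range] at ha
  rw [mul_sum]
  refine sum_congr rfl fun b hb => ?_
  rw [mem_range] at hb
  rw [sum_range_add, sum_range_mul_eq, mul_sum]
  have h : ∑ i ∈ range a, ∑ j ∈ range T, f (i * T + j) = 0 := by
    refine sum_eq_zero fun i hi => ?_
    rw [mem_range] at hi
    rw [sum_congr rfl fun j hj => hf i (hi.trans ha) j (mem_range.1 hj), ← mul_sum, h₀, mul_zero]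
  rw [h, zero_add]
  exact sum_congr rfl fun j hj => hf a ha j ((mem_range.1 hj).trans hb)

/-- Sum of the partial sums of a step sequence of powers of `q`, where the powers of `q`
below the number of steps sum to zero. -/
theorem sum_sum_range_step {R : Type*} [CommRing R] {f : ℕ → R} {q : R} {t N : ℕ}
    (hf : ∀ c < t, ∀ d < N, f (c * N + d) = q ^ c) (hq : ∑ c ∈ range t, q ^ c = 0) :
    (∑ k ∈ range (t * N), ∑ j ∈ range k, f j) * (q - 1) = -(N ^ 2 * t) := by
  have h : ∀ c ∈ range t, (∑ d ∈ range N, ∑ j ∈ range (c * N + d), f j) * (q - 1)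
      = (N ^ 2 + (∑ d ∈ range N, (d : R)) * (q - 1)) * q ^ c - N ^ 2 := by
    intro c hc
    rw [mem_range] at hc
    have h' : ∀ d ∈ range N, (∑ j ∈ range (c * N + d), f j) * (q - 1)
        = N * (q ^ c - 1) + d * ((q - 1) * q ^ c) := by
      intro d hd
      rw [mem_range] at hd
      rw [sum_range_add, sum_range_mul_eq,
        sum_congr rfl fun i hi => sum_congr rfl fun j hj =>
          hf i ((mem_range.1 hi).trans hc) j (mem_range.1 hj),
        sum_congr rfl fun j hj => hf c hc j ((mem_range.1 hj).trans hd)]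
      simp only [sum_const, card_range, nsmul_eq_mul, ← mul_sum]
      rw [← geom_sum_mul q c]
      ring
    rw [sum_mul, sum_congr rfl h', sum_add_distrib, ← sum_mul (range N) fun d => (d : R)]
    simp only [sum_const, card_range, nsmul_eq_mul]
    ring
  rw [sum_range_mul_eq, sum_mul, sum_congr rfl h, sum_sub_distrib, ← mul_sum, hq]
  simp only [sum_const, card_range, nsmul_eq_mul]
  ring

theorem sin_pi_div_le_sin_mul {u s : ℕ} (hs1 : 1 ≤ s) (hs2 : s < u) :
    Real.sin (Real.pi / u) ≤ Real.sin (s * (Real.pi / u)) := by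
  have hu : (0 : ℝ) < u := by exact_mod_cast (by omega : 0 < u)
  have hs1' : (1 : ℝ) ≤ s := by exact_mod_cast hs1
  have hs2' : (s : ℝ) + 1 ≤ u := by exact_mod_cast hs2
  set y := Real.pi / u with hy
  have hy0 : 0 < y := div_pos Real.pi_pos hu
  have hpi : Real.pi = u * y := by rw [hy]; field_simp
  rcases le_total (s * y) (Real.pi / 2) with h | h
  · exact Real.sin_le_sin_of_le_of_le_pi_div_two (by linarith [Real.pi_pos]) h (by nlinarith)
  · rw [← Real.sin_pi_sub (s * y)]
    exact Real.sin_le_sin_of_le_of_le_pi_div_two (by linarith [Real.pi_pos]) (by linarith) (by nlinarith)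

theorem one_le_norm_geom_sum_exp {u s : ℕ} (hs1 : 1 ≤ s) (hs2 : s < u) :
    1 ≤ ‖∑ a ∈ range s, Complex.exp (Complex.I * ((2 * Real.pi / u : ℝ) : ℂ)) ^ a‖ := by
  have hu : (1 : ℝ) < u := by exact_mod_cast (by omega : 1 < u)
  have hsin : 0 < Real.sin (Real.pi / u) :=
    Real.sin_pos_of_pos_of_lt_pi (by positivity) (div_lt_self Real.pi_pos hu)
  have hle := sin_pi_div_le_sin_mul hs1 hs2
  have h := congrArg norm
    (geom_sum_mul (Complex.exp (Complex.I * ((2 * Real.pi / u : ℝ) : ℂ))) s)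
  have hpow : Complex.exp (Complex.I * ((2 * Real.pi / u : ℝ) : ℂ)) ^ s
      = Complex.exp (Complex.I * ((s * (2 * Real.pi / u) : ℝ) : ℂ)) := by
    rw [← Complex.exp_nat_mul]
    push_cast
    ring_nf
  rw [norm_mul, hpow, Complex.norm_exp_I_mul_ofReal_sub_one,
    Complex.norm_exp_I_mul_ofReal_sub_one,
    show 2 * Real.pi / u / 2 = Real.pi / u by ring,
    show s * (2 * Real.pi / u) / 2 = s * (Real.pi / u) by ring,
    Real.norm_of_nonneg (by linarith), Real.norm_of_nonneg (by linarith)] at h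
  by_contra! hlt
  nlinarith

theorem isPrimitiveRoot_rad {m : ℕ → ℕ} {k : ℕ} {x : G m} (hm : 2 ≤ m k) (h : x k = 1) :
    IsPrimitiveRoot (rad m k x) (m k) := by
  have := Complex.isPrimitiveRoot_exp (m k) (by omega)
  rw [rad_eq_exp hm h]
  convert this using 2
  push_cast
  ring

theorem le_norm_K {m : ℕ → ℕ} (hm : ∀ k, 2 ≤ m k) {p s : ℕ} (hs1 : 1 ≤ s) (hs2 : s < m (p + 1))
    {x : G m} (hx : ∀ j < p, x j = 0) (hxp : x p = 1) (hxp' : x (p + 1) = 1) :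
    (M m (p + 1) : ℝ) / (2 * Real.pi * s) ≤ ‖K m (s * M m (p + 1)) x‖ := by
  have hN : 0 < M m p := M_pos hm p
  have hT : M m (p + 1) = m p * M m p := rfl
  have hT0 : 0 < M m (p + 1) := M_pos hm (p + 1)
  have ht : 0 < m p := by linarith [hm p]
  have hU : M m (p + 2) = m (p + 1) * M m (p + 1) := rfl
  have lt_of_digits : ∀ {a b c d : ℕ}, a < c → b < d → a * d + b < c * d := by
    intro a b c d hac hbd
    nlinarith
  have hprim := isPrimitiveRoot_rad (hm p) hxp
  have hgeom := hprim.geom_sum_eq_zero (hm p)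
  have hstep : ∀ c < m p, ∀ d < M m p, psi m (c * M m p + d) x = rad m p x ^ c := by
    intro c hc d hd
    have hlt : c * M m p + d < M m (p + 1) := lt_of_digits hc hd
    rw [psi_eq_mul hm hx (hlt.trans_le (M_mono hm (Nat.le_succ _))), digit_eq_zero_of_lt hlt,
      pow_zero, one_mul, digit, add_comm, Nat.add_mul_div_right _ _ hN, Nat.div_eq_of_lt hd,
      zero_add, Nat.mod_eq_of_lt hc]
  have hperiod : ∀ a < s, ∀ b < M m (p + 1),
      psi m (a * M m (p + 1) + b) x = rad m (p + 1) x ^ a * psi m b x := by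
    intro a ha b hb
    have hlt : a * M m (p + 1) + b < M m (p + 2) := lt_of_digits (ha.trans hs2) hb
    have h₁ : digit m (a * M m (p + 1) + b) (p + 1) = a := by
      rw [digit, add_comm, Nat.add_mul_div_right _ _ hT0, Nat.div_eq_of_lt hb, zero_add,
        Nat.mod_eq_of_lt (ha.trans hs2)]
    have h₂ : digit m (a * M m (p + 1) + b) p = digit m b p := by
      rw [digit, digit, hT, add_comm, ← mul_assoc, Nat.add_mul_div_right _ _ hN,
        Nat.add_mul_mod_self_right]
    rw [psi_eq_mul hm hx hlt, psi_eq_mul hm hx (hb.trans_le (M_mono hm (Nat.le_succ _))), h₁, h₂,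
      digit_eq_zero_of_lt hb, pow_zero, one_mul]
  have hD : ∑ j ∈ range (M m (p + 1)), psi m j x = 0 := by
    rw [hT, sum_range_mul_eq,
      sum_congr rfl fun c hc => sum_congr rfl fun d hd =>
        hstep c (mem_range.1 hc) d (mem_range.1 hd)]
    simp only [sum_const, ← smul_sum, hgeom, smul_zero]
  have hsum := sum_sum_range_step (f := fun k => psi m k x) hstep hgeom
  rw [← hT] at hsum
  have hq : ‖rad m p x - 1‖ ≤ 2 * Real.pi / m p := by
    rw [rad_eq_exp (hm p) hxp]
    refine Real.norm_exp_I_mul_ofReal_sub_one_le.trans_eq (Real.norm_of_nonneg (by positivity))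
  have hr : 1 ≤ ‖∑ a ∈ range s, rad m (p + 1) x ^ a‖ := by
    rw [rad_eq_exp (hm _) hxp']
    exact one_le_norm_geom_sum_exp hs1 hs2
  set Φ := ∑ k ∈ range (M m (p + 1)), ∑ j ∈ range k, psi m j x
  have hΦ : (M m (p + 1) : ℝ) ^ 2 / (2 * Real.pi) ≤ ‖Φ‖ := by
    have h := congrArg norm hsum
    simp only [norm_mul, norm_neg, norm_pow, Complex.norm_natCast] at h
    have h' := h.symm.trans_le (mul_le_mul_of_nonneg_left hq (norm_nonneg Φ))
    have ht' : (0 : ℝ) < m p := by exact_mod_cast ht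
    rw [← mul_div_assoc, le_div_iff₀ ht'] at h'
    rw [div_le_iff₀ (by positivity), hT]
    push_cast
    linarith
  have hT0' : (0 : ℝ) < M m (p + 1) := by exact_mod_cast hT0
  have hs0 : (0 : ℝ) < s := by exact_mod_cast hs1
  simp only [K, D]
  rw [sum_sum_range_quasiperiodic (f := fun k => psi m k x) hperiod hD, norm_mul, norm_mul, norm_inv, Complex.norm_natCast]
  push_cast
  calc (M m (p + 1) : ℝ) / (2 * Real.pi * s)
      = (s * M m (p + 1) : ℝ)⁻¹ * (1 * ((M m (p + 1) : ℝ) ^ 2 / (2 * Real.pi))) := by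
        field_simp
    _ ≤ _ := by gcongr

end Vilenkin

theorem statement6 (m : ℕ → ℕ) (hm : ∀ k, 2 ≤ m k) (n : ℕ) (hn : 1 ≤ n)
    (s : ℕ) (hs1 : 1 ≤ s) (hs2 : s ≤ m n - 1)
    (x : G m) (hx : x ∈ cyl m (n + 1) (e m (n - 1) + e m n)) :
    (M m n : ℝ) / (2 * Real.pi * s) ≤ ‖K m (s * M m n) x‖ := by
  obtain ⟨p, rfl⟩ : ∃ p, n = p + 1 := ⟨n - 1, by omega⟩
  have hx' : ∀ j < p + 2, x j = e m p j + e m (p + 1) j := hx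
  refine le_norm_K hm hs1 (by have := hm (p + 1); omega) (fun j hj => ?_) ?_ ?_
  · rw [hx' j (by omega), e, e, if_neg (by omega), if_neg (by omega), add_zero]
  · rw [hx' p (by omega), e, e, if_pos rfl, if_neg (by omega), add_zero]
  · rw [hx' (p + 1) (by omega), e, e, if_neg (by omega), if_pos rfl, zero_add]
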